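/- Let x, y : ℝ → S³ ⊂ ℝ⁴ be C¹ closed curves, periodic with periods L₁ > 0 and L₂ > 0, injective on a period and with nowhere-vanishing derivatives (so C₁ = image(x) and C₂ = image(y) are disjoint simple closed curves forming a 2-component link). Then the area of the product torus ∫₀^{L₁} ∫₀^{L₂} |A(s,t)| dt ds equals 0 if and only if there exists M ∈ M₅(ℝ) with B(Mu,Mv) = B(u,v) for all u, v ∈ ℝ⁵ and (M z̄)₀ > 0 for every z ∈ S³ such that the induced Möbius transformation T_M maps C₁ ∪ C₂ onto the standard Hopf link {(cos s, sin s, 0, 0) : s ∈ ℝ} ∪ {(0, 0, cos t, sin t) : t ∈ ℝ}. -/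

import Mathlib

open Matrix

/-- The Minkowski bilinear form on ℝ⁵. -/
noncomputable def MinkB (u v : Fin 5 → ℝ) : ℝ :=
  -(u 0 * v 0) + u 1 * v 1 + u 2 * v 2 + u 3 * v 3 + u 4 * v 4

/-- The lightlike lift `z̄ = (1, z) ∈ ℝ⁵` of a point of `S³ ⊂ ℝ⁴`. -/
noncomputable def lift (z : Fin 4 → ℝ) : Fin 5 → ℝ := Fin.cons 1 z

/-- The Möbius transformation of `S³` induced by a time-orientation preserving
pseudo-orthogonal matrix `M`. -/
noncomputable def Moeb (M : Matrix (Fin 5) (Fin 5) ℝ) (z : Fin 4 → ℝ) : Fin 4 → ℝ :=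
  fun i => M.mulVec (lift z) i.succ / M.mulVec (lift z) 0

/-- The standard Hopf link in `S³`: the union of the two unit circles
`{(cos s, sin s, 0, 0)}` and `{(0, 0, cos t, sin t)}`. -/
def stdHopfLink : Set (Fin 4 → ℝ) :=
  {p | ∃ s : ℝ, p = ![Real.cos s, Real.sin s, 0, 0]} ∪
  {p | ∃ t : ℝ, p = ![0, 0, Real.cos t, Real.sin t]}

lemma minkB_comm (u v : Fin 5 → ℝ) : MinkB u v = MinkB v u := by
  simp only [MinkB]; ring

lemma minkB_add_left (u v w : Fin 5 → ℝ) : MinkB (u + v) w = MinkB u w + MinkB v w := by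
  simp only [MinkB, Pi.add_apply]; ring

lemma minkB_sub_left (u v w : Fin 5 → ℝ) : MinkB (u - v) w = MinkB u w - MinkB v w := by
  simp only [MinkB, Pi.sub_apply]; ring

lemma minkB_smul_left (a : ℝ) (u w : Fin 5 → ℝ) : MinkB (a • u) w = a * MinkB u w := by
  simp only [MinkB, Pi.smul_apply, smul_eq_mul]; ring

lemma minkB_add_right (u v w : Fin 5 → ℝ) : MinkB w (u + v) = MinkB w u + MinkB w v := by
  simp only [MinkB, Pi.add_apply]; ring

lemma minkB_sub_right (u v w : Fin 5 → ℝ) : MinkB w (u - v) = MinkB w u - MinkB w v := by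
  simp only [MinkB, Pi.sub_apply]; ring

lemma minkB_smul_right (a : ℝ) (u w : Fin 5 → ℝ) : MinkB w (a • u) = a * MinkB w u := by
  simp only [MinkB, Pi.smul_apply, smul_eq_mul]; ring

lemma minkB_lift (z w : Fin 4 → ℝ) : MinkB (lift z) (lift w) = z ⬝ᵥ w - 1 := by
  have h (v : Fin 4 → ℝ) : lift v 0 = 1 ∧ lift v 1 = v 0 ∧ lift v 2 = v 1 ∧ lift v 3 = v 2 ∧
      lift v 4 = v 3 := ⟨rfl, rfl, rfl, rfl, rfl⟩
  simp only [MinkB, h, dotProduct, Fin.sum_univ_four]; ring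

lemma sq_sum_mul_le (a b : Fin 5 → ℝ) :
    (a 1 * b 1 + a 2 * b 2 + a 3 * b 3 + a 4 * b 4) ^ 2 ≤
      (a 1 ^ 2 + a 2 ^ 2 + a 3 ^ 2 + a 4 ^ 2) * (b 1 ^ 2 + b 2 ^ 2 + b 3 ^ 2 + b 4 ^ 2) := by
  have := Finset.sum_mul_sq_le_sq_mul_sq Finset.univ (fun i : Fin 4 => a i.succ)
    (fun i : Fin 4 => b i.succ)
  simpa [Fin.sum_univ_four] using this

/-- A nonzero vector orthogonal to a timelike vector is spacelike. -/
lemma minkB_self_pos_of_orthogonal_timelike {T w : Fin 5 → ℝ} (hT : MinkB T T < 0)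
    (hTw : MinkB T w = 0) (hw : w ≠ 0) : 0 < MinkB w w := by
  have hcs := sq_sum_mul_le T w
  simp only [MinkB] at *
  have hS : T 1 * w 1 + T 2 * w 2 + T 3 * w 3 + T 4 * w 4 = T 0 * w 0 := by linarith
  rw [hS] at hcs
  by_contra! hle
  set S := w 1 ^ 2 + w 2 ^ 2 + w 3 ^ 2 + w 4 ^ 2 with hSdef
  set R := T 1 ^ 2 + T 2 ^ 2 + T 3 ^ 2 + T 4 ^ 2 with hRdef
  have hw0 : S ≤ w 0 ^ 2 := by linarith
  have hT0 : R < T 0 ^ 2 := by linarith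
  have hR : 0 ≤ R := by positivity
  have h2 : w 0 ^ 2 = 0 := by
    by_contra hne
    have hpos : 0 < w 0 ^ 2 := lt_of_le_of_ne (sq_nonneg _) (Ne.symm hne)
    have h1 := mul_le_mul_of_nonneg_left hw0 hR
    have h3 := mul_lt_mul_of_pos_right hT0 hpos
    linarith [mul_pow (T 0) (w 0) 2]
  have hsq (a : ℝ) (ha : a ^ 2 ≤ 0) : a = 0 := pow_eq_zero_iff two_ne_zero |>.1
    (le_antisymm ha (sq_nonneg a))
  have n1 := sq_nonneg (w 1)
  have n2 := sq_nonneg (w 2)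
  have n3 := sq_nonneg (w 3)
  have n4 := sq_nonneg (w 4)
  apply hw
  funext i
  fin_cases i
  · exact hsq _ h2.le
  · exact hsq _ (show w 1 ^ 2 ≤ 0 by linarith)
  · exact hsq _ (show w 2 ^ 2 ≤ 0 by linarith)
  · exact hsq _ (show w 3 ^ 2 ≤ 0 by linarith)
  · exact hsq _ (show w 4 ^ 2 ≤ 0 by linarith)

/-- A timelike vector pairing negatively with some future lightlike vector is itself future
directed, hence pairs negatively with every lift. -/
lemma minkB_lift_neg_of_timelike {e f : Fin 5 → ℝ} (he : MinkB e e < 0) (hf : MinkB f f = 0)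
    (hf0 : 0 < f 0) (hef : MinkB e f < 0) {z : Fin 4 → ℝ} (hz : z ⬝ᵥ z = 1) :
    MinkB e (lift z) < 0 := by
  have key {g : Fin 5 → ℝ} (hg : MinkB g g = 0) (hg0 : 0 < g 0) :
      (e 1 * g 1 + e 2 * g 2 + e 3 * g 3 + e 4 * g 4) ^ 2 < (e 0 * g 0) ^ 2 := by
    have hcs := sq_sum_mul_le e g
    simp only [MinkB] at he hg
    have hgs : g 1 ^ 2 + g 2 ^ 2 + g 3 ^ 2 + g 4 ^ 2 = g 0 ^ 2 := by linarith
    rw [hgs] at hcs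
    have : 0 < g 0 ^ 2 := by positivity
    nlinarith
  have hl : MinkB (lift z) (lift z) = 0 := by rw [minkB_lift, hz, sub_self]
  have hl0 : lift z 0 = 1 := rfl
  have h1 := key hf hf0
  have h2 := key hl (by rw [hl0]; exact one_pos)
  have he0 : 0 < e 0 := by
    by_contra! hle
    have h3 : e 0 * f 0 ≤ 0 := mul_nonpos_of_nonpos_of_nonneg hle hf0.le
    have h4 := abs_lt_of_sq_lt_sq' (a := e 1 * f 1 + e 2 * f 2 + e 3 * f 3 + e 4 * f 4)
      (b := -(e 0 * f 0)) (by rwa [neg_sq]) (by linarith)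
    simp only [MinkB] at hef
    linarith [h4.1]
  have h5 := abs_lt_of_sq_lt_sq' h2 (by rw [hl0]; linarith)
  simp only [MinkB]
  linarith [h5.2]

/-- Gram–Schmidt for the differences of three lightlike vectors. -/
lemma exists_orthonormal_pair {T f₀ f₁ f₂ : Fin 5 → ℝ} (hT : MinkB T T < 0)
    (h₀ : MinkB f₀ f₀ = 0) (h₁ : MinkB f₁ f₁ = 0) (h₂ : MinkB f₂ f₂ = 0)
    (h₀₁ : MinkB f₀ f₁ < 0) (h₀₂ : MinkB f₀ f₂ < 0) (h₁₂ : MinkB f₁ f₂ < 0)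
    (hT₁ : MinkB T (f₁ - f₀) = 0) (hT₂ : MinkB T (f₂ - f₀) = 0) :
    ∃ u v : Fin 5 → ℝ, MinkB u u = 1 ∧ MinkB u v = 0 ∧ MinkB v v = 1 ∧
      (∃ a : ℝ, a ≠ 0 ∧ u = a • (f₁ - f₀)) ∧ ∃ b c : ℝ, v = b • (f₁ - f₀) + c • (f₂ - f₀) := by
  have h₁₀ := minkB_comm f₁ f₀
  have h₂₀ := minkB_comm f₂ f₀
  have h₂₁ := minkB_comm f₂ f₁
  set d := f₁ - f₀ with hd
  set d' := f₂ - f₀ with hd'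
  have hdd : MinkB d d = -2 * MinkB f₀ f₁ := by
    simp only [hd, minkB_sub_left, minkB_sub_right]; linarith
  have hdd' : MinkB d d' = MinkB f₁ f₂ - MinkB f₀ f₁ - MinkB f₀ f₂ := by
    simp only [hd, hd', minkB_sub_left, minkB_sub_right]; linarith
  have hdpos : 0 < MinkB d d := by linarith
  set w := (MinkB d d) • d' - (MinkB d d') • d with hw
  have hdw : MinkB d w = 0 := by
    simp only [hw, minkB_sub_right, minkB_smul_right]; ring
  have hw0 : w ≠ 0 := by
    intro h
    have hf₂ : MinkB w f₂ = 0 := by rw [h]; simp [MinkB]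
    have hf₁ : MinkB w f₁ = 0 := by rw [h]; simp [MinkB]
    simp only [hw, minkB_sub_left, minkB_smul_left] at hf₁ hf₂
    rw [hdd, hdd'] at hf₁ hf₂
    simp only [hd, hd', minkB_sub_left, h₁, h₂, h₂₁] at hf₁ hf₂
    have hp : 0 < MinkB f₀ f₁ * MinkB f₁ f₂ := mul_pos_of_neg_of_neg h₀₁ h₁₂
    nlinarith
  have hwpos : 0 < MinkB w w := minkB_self_pos_of_orthogonal_timelike hT
    (by simp only [hw, minkB_sub_right, minkB_smul_right, hT₁, hT₂]; ring) hw0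
  have hsd := Real.mul_self_sqrt hdpos.le
  have hsw := Real.mul_self_sqrt hwpos.le
  have hsd0 : √(MinkB d d) ≠ 0 := (Real.sqrt_pos.2 hdpos).ne'
  have hsw0 : √(MinkB w w) ≠ 0 := (Real.sqrt_pos.2 hwpos).ne'
  refine ⟨(√(MinkB d d))⁻¹ • d, (√(MinkB w w))⁻¹ • w, ?_, ?_, ?_,
    ⟨_, inv_ne_zero hsd0, rfl⟩,
    ⟨-((√(MinkB w w))⁻¹ * MinkB d d'), (√(MinkB w w))⁻¹ * MinkB d d, ?_⟩⟩
  · rw [minkB_smul_left, minkB_smul_right]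
    nth_rw 3 [← hsd]
    field_simp
  · rw [minkB_smul_left, minkB_smul_right, hdw]; ring
  · rw [minkB_smul_left, minkB_smul_right]
    nth_rw 3 [← hsw]
    field_simp
  · rw [hw]; module

/-- The coordinates in a Lorentz-orthonormal basis define a Lorentz transformation. -/
lemma exists_lorentz_of_orthonormal {e : Fin 5 → Fin 5 → ℝ}
    (he : ∀ i j, MinkB (e i) (e j) = if i = j then (if i = 0 then -1 else 1) else 0) :
    ∃ M : Matrix (Fin 5) (Fin 5) ℝ,
      (∀ u v : Fin 5 → ℝ, MinkB (M.mulVec u) (M.mulVec v) = MinkB u v) ∧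
      ∀ v i, M.mulVec v i = (if i = 0 then -1 else 1) * MinkB (e i) v := by
  let J : Matrix (Fin 5) (Fin 5) ℝ := diagonal fun i => if i = 0 then -1 else 1
  let E : Matrix (Fin 5) (Fin 5) ℝ := of e
  have hB (u v : Fin 5 → ℝ) : MinkB u v = u ⬝ᵥ (J *ᵥ v) := by
    simp [MinkB, J, mulVec_diagonal, dotProduct, Fin.sum_univ_five]
  have hJJ : J * J = 1 := by
    ext i j
    by_cases hij : i = j
    · subst hij; by_cases hi : i = 0 <;> simp [J, hi]
    · simp [J, hij]
  have hE : E * J * Eᵀ = J := by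
    ext i j
    have : (E * J * Eᵀ) i j = MinkB (e i) (e j) := by
      rw [hB, Matrix.mul_assoc, mul_apply]
      simp only [dotProduct, mulVec, mul_apply, E, of_apply, transpose_apply]
    rw [this, he]
    simp [J, diagonal_apply]
  have hinv : (J * E * J) * Eᵀ = 1 := by
    rw [Matrix.mul_assoc J E J, Matrix.mul_assoc, hE, hJJ]
  have hinv' : Eᵀ * (J * E * J) = 1 := mul_eq_one_comm.1 hinv
  have hJt : Jᵀ = J := diagonal_transpose _
  refine ⟨J * E * J, fun u v => ?_, fun v i => ?_⟩
  · have hM : (J * E * J)ᵀ * (J * (J * E * J)) = J := by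
      rw [transpose_mul, transpose_mul, hJt]
      calc J * (Eᵀ * J) * (J * (J * E * J)) = J * (Eᵀ * ((J * J) * (J * E * J))) := by
            simp only [Matrix.mul_assoc]
        _ = J := by rw [hJJ, Matrix.one_mul, hinv', Matrix.mul_one]
    rw [hB, hB, dotProduct_mulVec, vecMul_mulVec, ← dotProduct_mulVec, mulVec_mulVec,
      Matrix.mul_assoc _ J, hM]
  · rw [Matrix.mul_assoc, ← mulVec_mulVec, mulVec_diagonal, ← mulVec_mulVec, hB]
    rfl

/-- Two families of lightlike vectors with constant mutual product `-1` are moved by a Lorentz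
transformation into complementary coordinate subspaces. -/
lemma exists_lorentz_splitting {ι κ : Type*} {X : ι → Fin 5 → ℝ} {Y : κ → Fin 5 → ℝ}
    (hX : ∀ s, MinkB (X s) (X s) = 0) (hY : ∀ t, MinkB (Y t) (Y t) = 0)
    (hXY : ∀ s t, MinkB (X s) (Y t) = -1) {s₀ s₁ s₂ : ι} {t₀ t₁ t₂ : κ}
    (hs₀₁ : MinkB (X s₀) (X s₁) < 0) (hs₀₂ : MinkB (X s₀) (X s₂) < 0)
    (hs₁₂ : MinkB (X s₁) (X s₂) < 0)
    (ht₀₁ : MinkB (Y t₀) (Y t₁) < 0) (ht₀₂ : MinkB (Y t₀) (Y t₂) < 0)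
    (ht₁₂ : MinkB (Y t₁) (Y t₂) < 0) (hY0 : 0 < Y t₀ 0) :
    ∃ M : Matrix (Fin 5) (Fin 5) ℝ,
      (∀ u v : Fin 5 → ℝ, MinkB (M.mulVec u) (M.mulVec v) = MinkB u v) ∧
      (∀ z : Fin 4 → ℝ, z ⬝ᵥ z = 1 → 0 < M.mulVec (lift z) 0) ∧
      (∀ s, M.mulVec (X s) 3 = 0 ∧ M.mulVec (X s) 4 = 0) ∧
      ∀ t, M.mulVec (Y t) 1 = 0 ∧ M.mulVec (Y t) 2 = 0 := by
  have hYX (s t) : MinkB (Y t) (X s) = -1 := by rw [minkB_comm, hXY]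
  have hTX : MinkB (X s₀ + X s₁) (X s₀ + X s₁) < 0 := by
    simp only [minkB_add_left, minkB_add_right, hX, minkB_comm (X s₁) (X s₀)]; linarith
  have hTY : MinkB (Y t₀ + Y t₁) (Y t₀ + Y t₁) < 0 := by
    simp only [minkB_add_left, minkB_add_right, hY, minkB_comm (Y t₁) (Y t₀)]; linarith
  obtain ⟨u, u', huu, huu', hu'u', ⟨a, ha, hu⟩, ⟨b, c, hu'⟩⟩ :=
    exists_orthonormal_pair hTY (hX s₀) (hX s₁) (hX s₂) hs₀₁ hs₀₂ hs₁₂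
      (by simp [minkB_add_left, minkB_sub_right, hYX])
      (by simp [minkB_add_left, minkB_sub_right, hYX])
  obtain ⟨v, v', hvv, hvv', hv'v', ⟨a', -, hv⟩, ⟨b', c', hv'⟩⟩ :=
    exists_orthonormal_pair hTX (hY t₀) (hY t₁) (hY t₂) ht₀₁ ht₀₂ ht₁₂
      (by simp [minkB_add_left, minkB_sub_right, hXY])
      (by simp [minkB_add_left, minkB_sub_right, hXY])
  have huY (t) : MinkB u (Y t) = 0 := by
    simp [hu, minkB_smul_left, minkB_sub_left, hXY]
  have hu'Y (t) : MinkB u' (Y t) = 0 := by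
    simp [hu', minkB_add_left, minkB_smul_left, minkB_sub_left, hXY]
  have hvX (s) : MinkB v (X s) = 0 := by
    simp [hv, minkB_smul_left, minkB_sub_left, hYX]
  have hv'X (s) : MinkB v' (X s) = 0 := by
    simp [hv', minkB_add_left, minkB_smul_left, minkB_sub_left, hYX]
  have huv : MinkB u v = 0 := by simp [hv, minkB_smul_right, minkB_sub_right, huY]
  have huv' : MinkB u v' = 0 := by
    simp [hv', minkB_add_right, minkB_smul_right, minkB_sub_right, huY]
  have hu'v : MinkB u' v = 0 := by simp [hv, minkB_smul_right, minkB_sub_right, hu'Y]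
  have hu'v' : MinkB u' v' = 0 := by
    simp [hv', minkB_add_right, minkB_smul_right, minkB_sub_right, hu'Y]
  set p := X s₀ - (MinkB u (X s₀)) • u - (MinkB u' (X s₀)) • u' with hp
  have hpp : MinkB p p = -(MinkB u (X s₀) ^ 2 + MinkB u' (X s₀) ^ 2) := by
    simp only [hp, minkB_sub_left, minkB_sub_right, minkB_smul_left, minkB_smul_right, hX,
      minkB_comm (X s₀), huu, huu', hu'u', minkB_comm u' u]
    ring
  have huX : MinkB u (X s₀) ≠ 0 := by
    rw [hu, minkB_smul_left, minkB_sub_left, hX, minkB_comm]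
    exact mul_ne_zero ha (by linarith)
  have hppneg : MinkB p p < 0 := by
    have : 0 < MinkB u (X s₀) ^ 2 := by positivity
    rw [hpp]; nlinarith [sq_nonneg (MinkB u' (X s₀))]
  have hup : MinkB u p = 0 := by
    simp only [hp, minkB_sub_right, minkB_smul_right, huu, huu']; ring
  have hu'p : MinkB u' p = 0 := by
    simp only [hp, minkB_sub_right, minkB_smul_right, hu'u', minkB_comm u' u, huu']; ring
  have hvp : MinkB v p = 0 := by
    simp only [hp, minkB_sub_right, minkB_smul_right, hvX, minkB_comm v u, minkB_comm v u', huv,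
      hu'v, mul_zero, sub_zero]
  have hv'p : MinkB v' p = 0 := by
    simp only [hp, minkB_sub_right, minkB_smul_right, hv'X, minkB_comm v' u, minkB_comm v' u',
      huv', hu'v', mul_zero, sub_zero]
  have hpY : MinkB p (Y t₀) = -1 := by
    simp [hp, minkB_sub_left, minkB_smul_left, hXY, huY, hu'Y]
  have hrpos : 0 < √(-MinkB p p) := Real.sqrt_pos.2 (by linarith)
  have hr := Real.mul_self_sqrt (show 0 ≤ -MinkB p p by linarith)
  set r := √(-MinkB p p)
  set q := r⁻¹ • p with hq
  have hqq : MinkB q q = -1 := by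
    rw [hq, minkB_smul_left, minkB_smul_right, show MinkB p p = -(r * r) by linarith]
    field_simp
  obtain ⟨M, hM, hMv⟩ := exists_lorentz_of_orthonormal (e := ![q, u, u', v, v']) (by
    have h1 : MinkB u q = 0 := by rw [hq, minkB_smul_right, hup, mul_zero]
    have h2 : MinkB u' q = 0 := by rw [hq, minkB_smul_right, hu'p, mul_zero]
    have h3 : MinkB v q = 0 := by rw [hq, minkB_smul_right, hvp, mul_zero]
    have h4 : MinkB v' q = 0 := by rw [hq, minkB_smul_right, hv'p, mul_zero]
    have h1' := (minkB_comm q u).trans h1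
    have h2' := (minkB_comm q u').trans h2
    have h3' := (minkB_comm q v).trans h3
    have h4' := (minkB_comm q v').trans h4
    have h5 := (minkB_comm u' u).trans huu'
    have h6 := (minkB_comm v' v).trans hvv'
    have h7 := (minkB_comm v u).trans huv
    have h8 := (minkB_comm v u').trans hu'v
    have h9 := (minkB_comm v' u).trans huv'
    have h10 := (minkB_comm v' u').trans hu'v'
    intro i j
    fin_cases i <;> fin_cases j <;> simp <;> assumption)
  refine ⟨M, hM, fun z hz => ?_, fun s => ?_, fun t => ?_⟩
  · have hneg := minkB_lift_neg_of_timelike hppneg (hY t₀) hY0 (by rw [hpY]; norm_num) hz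
    have : M.mulVec (lift z) 0 = r⁻¹ * -MinkB p (lift z) := by
      rw [hMv]; simp [hq, minkB_smul_left]
    rw [this]
    exact mul_pos (inv_pos.2 hrpos) (by linarith)
  · constructor <;> rw [hMv] <;> simp [hvX, hv'X]
  · constructor <;> rw [hMv] <;> simp [huY, hu'Y]

lemma dotProduct_sub_one_neg {n : Type*} [Fintype n] {z w : n → ℝ} (hz : z ⬝ᵥ z = 1)
    (hw : w ⬝ᵥ w = 1) (h : z ≠ w) : z ⬝ᵥ w - 1 < 0 := by
  have h1 : 0 < (z - w) ⬝ᵥ (z - w) := by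
    refine lt_of_le_of_ne (Finset.sum_nonneg fun i _ => mul_self_nonneg _) fun h0 => ?_
    exact h (sub_eq_zero.1 (dotProduct_self_eq_zero.1 h0.symm))
  simp only [sub_dotProduct, dotProduct_sub, hz, hw, dotProduct_comm w z] at h1
  linarith

lemma dotProduct_sub_one_eq_moeb {M : Matrix (Fin 5) (Fin 5) ℝ}
    (hM : ∀ u v : Fin 5 → ℝ, MinkB (M.mulVec u) (M.mulVec v) = MinkB u v) {z w : Fin 4 → ℝ}
    (hz : M.mulVec (lift z) 0 ≠ 0) (hw : M.mulVec (lift w) 0 ≠ 0) :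
    z ⬝ᵥ w - 1 =
      M.mulVec (lift z) 0 * M.mulVec (lift w) 0 * (Moeb M z ⬝ᵥ Moeb M w - 1) := by
  rw [← minkB_lift, ← hM]
  have h1 : (Fin.succ 1 : Fin 5) = 2 := rfl
  have h2 : (Fin.succ 2 : Fin 5) = 3 := rfl
  have h3 : (Fin.succ 3 : Fin 5) = 4 := rfl
  have h0 : (Fin.succ 0 : Fin 5) = 1 := rfl
  simp only [MinkB, Moeb, dotProduct, Fin.sum_univ_four, h0, h1, h2, h3]
  generalize M.mulVec (lift z) = Z at *
  generalize M.mulVec (lift w) = W at *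
  field_simp
  ring

/-- An injectively parametrised closed curve in the unit circle covers it. -/
lemma exists_eq_cos_sin_of_periodic_injOn {p q : ℝ → ℝ} {L : ℝ} (hL : 0 < L)
    (hp : Continuous p) (hq : Continuous q) (hpq : ∀ s, p s ^ 2 + q s ^ 2 = 1)
    (hpL : p L = p 0) (hqL : q L = q 0)
    (hinj : Set.InjOn (fun s => (p s, q s)) (Set.Ico 0 L)) (θ : ℝ) :
    ∃ s, p s = Real.cos θ ∧ q s = Real.sin θ := by
  by_contra! hne
  have hcs := Real.sin_sq_add_cos_sq θ
  set c := Real.cos θ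
  set d := Real.sin θ
  let P s := c * p s + d * q s
  let Q s := c * q s - d * p s
  have hPQ s : P s ^ 2 + Q s ^ 2 = 1 := by
    calc P s ^ 2 + Q s ^ 2 = (d ^ 2 + c ^ 2) * (p s ^ 2 + q s ^ 2) := by simp only [P, Q]; ring
      _ = 1 := by rw [hcs, hpq, one_mul]
  have hpP s : p s = c * P s - d * Q s := by
    calc p s = (d ^ 2 + c ^ 2) * p s := by rw [hcs, one_mul]
      _ = _ := by simp only [P, Q]; ring
  have hqP s : q s = d * P s + c * Q s := by
    calc q s = (d ^ 2 + c ^ 2) * q s := by rw [hcs, one_mul]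
      _ = _ := by simp only [P, Q]; ring
  have hP1 s : 1 - P s ≠ 0 := by
    intro h
    have h1 : P s = 1 := by linarith
    have h2 : Q s = 0 := by
      have := hPQ s
      rw [h1] at this
      exact pow_eq_zero_iff two_ne_zero |>.1 (by linarith)
    refine hne s ?_ ?_
    · rw [hpP, h1, h2]; ring
    · rw [hqP, h1, h2]; ring
  let g s := Q s / (1 - P s)
  have hg : Continuous g := by
    refine Continuous.div ?_ ?_ hP1 <;> simp only [P, Q] <;> fun_prop
  have hgL : g L = g 0 := by simp only [g, P, Q, hpL, hqL]
  have hginj : Set.InjOn g (Set.Ico 0 L) := by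
    intro s hs s' hs' h
    have h1 : Q s * (1 - P s') = Q s' * (1 - P s) := by
      rwa [div_eq_div_iff (hP1 s) (hP1 s')] at h
    have h2 : (1 - P s ^ 2) * (1 - P s') ^ 2 = (1 - P s' ^ 2) * (1 - P s) ^ 2 := by
      have := congrArg (· ^ 2) h1
      simp only [mul_pow] at this
      rwa [show Q s ^ 2 = 1 - P s ^ 2 by linarith [hPQ s],
        show Q s' ^ 2 = 1 - P s' ^ 2 by linarith [hPQ s']] at this
    have h3 : (1 + P s) * (1 - P s') = (1 + P s') * (1 - P s) := by
      apply mul_left_cancel₀ (mul_ne_zero (hP1 s) (hP1 s'))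
      linear_combination h2
    have h4 : P s = P s' := by linarith
    have h5 : Q s = Q s' := by
      rw [h4] at h1; exact mul_right_cancel₀ (hP1 s') h1
    exact hinj hs hs' (by simp only [hpP, hqP, h4, h5])
  have hmid : g (L / 2) ≠ g 0 := fun h => by
    have := hginj ⟨by positivity, by linarith⟩ ⟨le_rfl, hL⟩ h
    linarith
  obtain ⟨s, hs, hsm⟩ : (g 0 + g (L / 2)) / 2 ∈ g '' Set.uIcc 0 (L / 2) :=
    intermediate_value_uIcc hg.continuousOn
      (by rcases le_total (g 0) (g (L / 2)) with h | h <;>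
        simp only [Set.mem_uIcc] <;> [left; right] <;> constructor <;> linarith)
  obtain ⟨s', hs', hsm'⟩ : (g 0 + g (L / 2)) / 2 ∈ g '' Set.uIcc (L / 2) L :=
    intermediate_value_uIcc hg.continuousOn
      (by rw [hgL]; rcases le_total (g 0) (g (L / 2)) with h | h <;>
        simp only [Set.mem_uIcc] <;> [right; left] <;> constructor <;> linarith)
  rw [Set.uIcc_of_le (by linarith)] at hs hs'
  have hs'L : s' ≠ L := by
    rintro rfl
    apply hmid; linarith
  have hss' := hginj ⟨hs.1, by linarith [hs.2]⟩
    ⟨by linarith [hs'.1], lt_of_le_of_ne hs'.2 hs'L⟩ (hsm.trans hsm'.symm)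
  have : s = L / 2 := le_antisymm hs.2 (hss' ▸ hs'.1)
  rw [this] at hsm
  apply hmid; linarith

lemma hasDerivAt_dotProduct_const {n : Type*} [Fintype n] {x : ℝ → n → ℝ} {s : ℝ}
    (hx : DifferentiableAt ℝ x s) (v : n → ℝ) :
    HasDerivAt (fun s => x s ⬝ᵥ v) (deriv x s ⬝ᵥ v) s := by
  simp only [dotProduct]
  exact HasDerivAt.fun_sum fun i _ => ((hasDerivAt_pi.1 hx.hasDerivAt) i).mul_const _

lemma hasDerivAt_const_dotProduct {n : Type*} [Fintype n] {x : ℝ → n → ℝ} {s : ℝ}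
    (hx : DifferentiableAt ℝ x s) (v : n → ℝ) :
    HasDerivAt (fun s => v ⬝ᵥ x s) (v ⬝ᵥ deriv x s) s := by
  simpa only [dotProduct_comm v] using hasDerivAt_dotProduct_const hx v

/-- The area density of two curves vanishes identically iff `x s ⬝ᵥ y t - 1` is a product of
a function of `s` and a function of `t`. -/
lemma areaDensity_eq_zero_iff {n : Type*} [Fintype n] {x y : ℝ → n → ℝ}
    (hx : Differentiable ℝ x) (hy : Differentiable ℝ y) (hne : ∀ s t, x s ⬝ᵥ y t - 1 ≠ 0) :
    (∀ s t, (deriv x s ⬝ᵥ deriv y t) * (x s ⬝ᵥ y t - 1)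
        - (deriv x s ⬝ᵥ y t) * (x s ⬝ᵥ deriv y t) = 0) ↔
      ∀ s s' t t', (x s ⬝ᵥ y t - 1) * (x s' ⬝ᵥ y t' - 1) =
        (x s ⬝ᵥ y t' - 1) * (x s' ⬝ᵥ y t - 1) := by
  constructor
  · intro h s s' t t'
    have h1 (t : ℝ) : (x s ⬝ᵥ deriv y t) / (x s ⬝ᵥ y t - 1) =
        (x s' ⬝ᵥ deriv y t) / (x s' ⬝ᵥ y t - 1) := by
      have hd (s : ℝ) : HasDerivAt (fun s => (x s ⬝ᵥ deriv y t) / (x s ⬝ᵥ y t - 1)) 0 s := by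
        have := (hasDerivAt_dotProduct_const (hx s) (deriv y t)).div
          ((hasDerivAt_dotProduct_const (hx s) (y t)).sub_const 1) (hne s t)
        exact this.congr_deriv (by rw [mul_comm (x s ⬝ᵥ deriv y t), h, zero_div])
      exact is_const_of_deriv_eq_zero (fun s => (hd s).differentiableAt)
        (fun s => (hd s).deriv) s s'
    have h2 : (x s ⬝ᵥ y t - 1) / (x s' ⬝ᵥ y t - 1) =
        (x s ⬝ᵥ y t' - 1) / (x s' ⬝ᵥ y t' - 1) := by
      have hd (t : ℝ) : HasDerivAt (fun t => (x s ⬝ᵥ y t - 1) / (x s' ⬝ᵥ y t - 1)) 0 t := by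
        have := ((hasDerivAt_const_dotProduct (hy t) (x s)).sub_const 1).div
          ((hasDerivAt_const_dotProduct (hy t) (x s')).sub_const 1) (hne s' t)
        refine this.congr_deriv ?_
        have h3 := h1 t
        rw [div_eq_div_iff (hne s t) (hne s' t)] at h3
        rw [h3, mul_comm (x s' ⬝ᵥ deriv y t), sub_self, zero_div]
      exact is_const_of_deriv_eq_zero (fun s => (hd s).differentiableAt)
        (fun s => (hd s).deriv) t t'
    rwa [div_eq_div_iff (hne s' t) (hne s' t')] at h2
  · intro h s t
    have h1 (t' : ℝ) : (deriv x s ⬝ᵥ y t') * (x s ⬝ᵥ y t - 1) =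
        (deriv x s ⬝ᵥ y t) * (x s ⬝ᵥ y t' - 1) := by
      have hl := ((hasDerivAt_dotProduct_const (hx s) (y t')).sub_const 1).mul_const
        (x s ⬝ᵥ y t - 1)
      have hr := ((hasDerivAt_dotProduct_const (hx s) (y t)).sub_const 1).mul_const
        (x s ⬝ᵥ y t' - 1)
      rw [← funext fun s' => h s' s t' t] at hr
      exact hl.unique hr
    have hl := (hasDerivAt_const_dotProduct (hy t) (deriv x s)).mul_const (x s ⬝ᵥ y t - 1)
    have hr := ((hasDerivAt_const_dotProduct (hy t) (x s)).sub_const 1).const_mul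
      (deriv x s ⬝ᵥ y t)
    rw [← funext h1] at hr
    rw [hl.unique hr, sub_self]

lemma deriv_periodic {E : Type*} [NormedAddCommGroup E] [NormedSpace ℝ E] {f : ℝ → E} {L : ℝ}
    (hf : Function.Periodic f L) : Function.Periodic (deriv f) L := fun s => by
  rw [← deriv_comp_add_const, funext hf]

/-- A continuous nonnegative doubly periodic function with vanishing integral over a period
rectangle is zero. -/
lemma eq_zero_of_integral_integral_eq_zero {f : ℝ → ℝ → ℝ} {L₁ L₂ : ℝ} (hL₁ : 0 < L₁)
    (hL₂ : 0 < L₂) (hf : Continuous (Function.uncurry f)) (hf0 : ∀ s t, 0 ≤ f s t)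
    (hf₁ : Function.Periodic f L₁) (hf₂ : ∀ s, Function.Periodic (f s) L₂)
    (h : ∫ s in (0:ℝ)..L₁, ∫ t in (0:ℝ)..L₂, f s t = 0) (s t : ℝ) : f s t = 0 := by
  obtain ⟨s', hs', hss'⟩ := hf₁.exists_mem_Ico₀ hL₁ s
  obtain ⟨t', ht', htt'⟩ := (hf₂ s').exists_mem_Ico₀ hL₂ t
  rw [hss', htt']
  have hcont : Continuous fun s => ∫ t in (0:ℝ)..L₂, f s t :=
    intervalIntegral.continuous_parametric_intervalIntegral_of_continuous' hf 0 L₂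
  by_contra hne
  have hpos : 0 < f s' t' := lt_of_le_of_ne (hf0 _ _) (Ne.symm hne)
  have h1 : 0 < ∫ t in (0:ℝ)..L₂, f s' t :=
    intervalIntegral.integral_pos hL₂ (hf.comp (Continuous.prodMk_right s')).continuousOn
      (fun t _ => hf0 _ _) ⟨t', Set.Ico_subset_Icc_self ht', hpos⟩
  have h2 := intervalIntegral.integral_pos hL₁ hcont.continuousOn
    (fun s _ => intervalIntegral.integral_nonneg hL₂.le fun t _ => hf0 s t)
    ⟨s', Set.Ico_subset_Icc_self hs', h1⟩
  exact h2.ne' h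

lemma continuous_moeb_comp {M : Matrix (Fin 5) (Fin 5) ℝ} {x : ℝ → Fin 4 → ℝ}
    (hx : Continuous x) (hpos : ∀ s, 0 < M.mulVec (lift (x s)) 0) :
    Continuous fun s => Moeb M (x s) := by
  have hl : Continuous fun s => M.mulVec (lift (x s)) := by
    refine Continuous.matrix_mulVec continuous_const (continuous_pi fun i => ?_)
    refine Fin.cases ?_ (fun j => ?_) i
    · exact continuous_const
    · exact (continuous_apply j).comp hx
  exact continuous_pi fun i => ((continuous_apply _).comp hl).div ((continuous_apply _).comp hl)
    fun s => (hpos s).ne'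

lemma moeb_self_dotProduct {M : Matrix (Fin 5) (Fin 5) ℝ}
    (hM : ∀ u v : Fin 5 → ℝ, MinkB (M.mulVec u) (M.mulVec v) = MinkB u v)
    (hpos : ∀ z : Fin 4 → ℝ, z ⬝ᵥ z = 1 → 0 < M.mulVec (lift z) 0) {z : Fin 4 → ℝ}
    (hz : z ⬝ᵥ z = 1) : Moeb M z ⬝ᵥ Moeb M z = 1 := by
  have h := dotProduct_sub_one_eq_moeb hM (hpos z hz).ne' (hpos z hz).ne'
  rw [hz, sub_self, eq_comm, mul_eq_zero] at h
  rcases h with h | h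
  · exact absurd h (mul_pos (hpos z hz) (hpos z hz)).ne'
  · linarith

lemma moeb_injOn_sphere {M : Matrix (Fin 5) (Fin 5) ℝ}
    (hM : ∀ u v : Fin 5 → ℝ, MinkB (M.mulVec u) (M.mulVec v) = MinkB u v)
    (hpos : ∀ z : Fin 4 → ℝ, z ⬝ᵥ z = 1 → 0 < M.mulVec (lift z) 0) :
    Set.InjOn (Moeb M) {z | z ⬝ᵥ z = 1} := by
  intro z hz w hw h
  by_contra hne
  have h1 := dotProduct_sub_one_neg hz hw hne
  have h2 := dotProduct_sub_one_eq_moeb hM (hpos z hz).ne' (hpos w hw).ne'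
  rw [h, moeb_self_dotProduct hM hpos hw, sub_self, mul_zero] at h2
  exact h1.ne h2

/-- A connected curve in the Hopf link stays in one component. -/
lemma mem_component_of_mem_stdHopfLink {c : ℝ → Fin 4 → ℝ} (hc : Continuous c)
    (h : ∀ s, c s ∈ stdHopfLink) :
    (∀ s, c s 2 = 0 ∧ c s 3 = 0) ∨ ∀ s, c s 0 = 0 ∧ c s 1 = 0 := by
  have key (s) : (c s 0 ^ 2 + c s 1 ^ 2 = 1 ∧ c s 2 = 0 ∧ c s 3 = 0) ∨
      (c s 0 ^ 2 + c s 1 ^ 2 = 0 ∧ c s 0 = 0 ∧ c s 1 = 0) := by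
    rcases h s with ⟨θ, hθ⟩ | ⟨θ, hθ⟩
    · left; rw [hθ]; simp
    · right; rw [hθ]; simp
  by_contra! hne
  obtain ⟨⟨s, hs⟩, ⟨t, ht⟩⟩ := hne
  have hs0 : c s 0 ^ 2 + c s 1 ^ 2 = 0 := by
    rcases key s with h | h
    · exact absurd h.2.2 (hs h.2.1)
    · exact h.1
  have ht1 : c t 0 ^ 2 + c t 1 ^ 2 = 1 := by
    rcases key t with h | h
    · exact h.1
    · exact absurd h.2.2 (ht h.2.1)
  have hcont : Continuous fun s => c s 0 ^ 2 + c s 1 ^ 2 := by fun_prop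
  obtain ⟨r, hr⟩ := mem_range_of_exists_le_of_exists_ge (c := (1 / 2 : ℝ)) hcont
    ⟨s, by rw [hs0]; norm_num⟩ ⟨t, by rw [ht1]; norm_num⟩
  rcases key r with h | h <;> norm_num [h.1] at hr

lemma exists_cos_sin_of_sq_add_sq_eq_one {a b : ℝ} (h : a ^ 2 + b ^ 2 = 1) :
    ∃ θ : ℝ, a = Real.cos θ ∧ b = Real.sin θ := by
  have hn : ‖(⟨a, b⟩ : ℂ)‖ = 1 := by
    rw [Complex.norm_def, Complex.normSq_mk, ← sq, ← sq, h, Real.sqrt_one]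
  obtain ⟨θ, hθ⟩ := (Complex.norm_eq_one_iff _).1 hn
  refine ⟨θ, ?_, ?_⟩
  · rw [← Complex.exp_ofReal_mul_I_re, hθ]
  · rw [← Complex.exp_ofReal_mul_I_im, hθ]

lemma dotProduct_sub_one_neg_of_injOn {n : Type*} [Fintype n] {x : ℝ → n → ℝ} {L : ℝ}
    (hxS : ∀ s, x s ⬝ᵥ x s = 1) (hinj : Set.InjOn x (Set.Ico 0 L)) {s s' : ℝ} (hs : 0 ≤ s)
    (hss' : s < s') (hs' : s' < L) : x s ⬝ᵥ x s' - 1 < 0 :=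
  dotProduct_sub_one_neg (hxS s) (hxS s') fun h =>
    hss'.ne (hinj ⟨hs, hss'.trans hs'⟩ ⟨hs.trans hss'.le, hs'⟩ h)

/-- If `x s ⬝ᵥ y t - 1` is a product, a Lorentz transformation moves the two curves into the
two coordinate circles. -/
lemma exists_lorentz_of_product {x y : ℝ → Fin 4 → ℝ} {L₁ L₂ : ℝ}
    (hxS : ∀ s, x s ⬝ᵥ x s = 1) (hyS : ∀ t, y t ⬝ᵥ y t = 1) (hL₁ : 0 < L₁) (hL₂ : 0 < L₂)
    (hxinj : Set.InjOn x (Set.Ico 0 L₁)) (hyinj : Set.InjOn y (Set.Ico 0 L₂))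
    (hdisj : ∀ s t, x s ≠ y t)
    (h : ∀ s s' t t', (x s ⬝ᵥ y t - 1) * (x s' ⬝ᵥ y t' - 1) =
        (x s ⬝ᵥ y t' - 1) * (x s' ⬝ᵥ y t - 1)) :
    ∃ M : Matrix (Fin 5) (Fin 5) ℝ,
      (∀ u v : Fin 5 → ℝ, MinkB (M.mulVec u) (M.mulVec v) = MinkB u v) ∧
      (∀ z : Fin 4 → ℝ, z ⬝ᵥ z = 1 → 0 < M.mulVec (lift z) 0) ∧
      (∀ s, Moeb M (x s) 2 = 0 ∧ Moeb M (x s) 3 = 0) ∧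
      ∀ t, Moeb M (y t) 0 = 0 ∧ Moeb M (y t) 1 = 0 := by
  have hneg (s t) := dotProduct_sub_one_neg (hxS s) (hyS t) (hdisj s t)
  let a s := -(x s ⬝ᵥ y 0 - 1)⁻¹
  let b t := (x 0 ⬝ᵥ y 0 - 1) / (x 0 ⬝ᵥ y t - 1)
  have ha s : 0 < a s := neg_pos.2 (inv_lt_zero.2 (hneg s 0))
  have hb t : 0 < b t := div_pos_of_neg_of_neg (hneg 0 0) (hneg 0 t)
  have hneg' {c d e : ℝ} (hc : 0 < c) (hd : 0 < d) (he : e < 0) : c * (d * e) < 0 :=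
    mul_neg_of_pos_of_neg hc (mul_neg_of_pos_of_neg hd he)
  have hX s s' : MinkB (a s • lift (x s)) (a s' • lift (x s')) =
      a s * (a s' * (x s ⬝ᵥ x s' - 1)) := by
    rw [minkB_smul_left, minkB_smul_right, minkB_lift]
  have hY t t' : MinkB (b t • lift (y t)) (b t' • lift (y t')) =
      b t * (b t' * (y t ⬝ᵥ y t' - 1)) := by
    rw [minkB_smul_left, minkB_smul_right, minkB_lift]
  obtain ⟨M, hM, hpos, hMX, hMY⟩ := exists_lorentz_splitting
    (X := fun s => a s • lift (x s)) (Y := fun t => b t • lift (y t))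
    (s₀ := 0) (s₁ := L₁ / 3) (s₂ := L₁ / 2) (t₀ := 0) (t₁ := L₂ / 3) (t₂ := L₂ / 2)
    (fun s => by rw [hX, hxS, sub_self, mul_zero, mul_zero])
    (fun t => by rw [hY, hyS, sub_self, mul_zero, mul_zero])
    (fun s t => by
      rw [minkB_smul_left, minkB_smul_right, minkB_lift]
      have h1 := (hneg s 0).ne
      have h2 := (hneg 0 t).ne
      have h3 := h s 0 t 0
      simp only [a, b]
      field_simp
      linear_combination -h3)
    (by rw [hX]; exact hneg' (ha _) (ha _) (dotProduct_sub_one_neg_of_injOn hxS hxinj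
      le_rfl (by linarith) (by linarith)))
    (by rw [hX]; exact hneg' (ha _) (ha _) (dotProduct_sub_one_neg_of_injOn hxS hxinj
      le_rfl (by linarith) (by linarith)))
    (by rw [hX]; exact hneg' (ha _) (ha _) (dotProduct_sub_one_neg_of_injOn hxS hxinj
      (by linarith) (by linarith) (by linarith)))
    (by rw [hY]; exact hneg' (hb _) (hb _) (dotProduct_sub_one_neg_of_injOn hyS hyinj
      le_rfl (by linarith) (by linarith)))
    (by rw [hY]; exact hneg' (hb _) (hb _) (dotProduct_sub_one_neg_of_injOn hyS hyinj
      le_rfl (by linarith) (by linarith)))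
    (by rw [hY]; exact hneg' (hb _) (hb _) (dotProduct_sub_one_neg_of_injOn hyS hyinj
      (by linarith) (by linarith) (by linarith)))
    (by simpa [lift] using hb 0)
  have hzero {c : ℝ} (hc : 0 < c) {z : Fin 4 → ℝ} {i : Fin 4}
      (hi : M.mulVec (c • lift z) i.succ = 0) : Moeb M z i = 0 := by
    rw [mulVec_smul, Pi.smul_apply, smul_eq_mul, mul_eq_zero] at hi
    rw [Moeb, hi.resolve_left hc.ne', zero_div]
  exact ⟨M, hM, hpos, fun s => ⟨hzero (ha s) (hMX s).1, hzero (ha s) (hMX s).2⟩,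
    fun t => ⟨hzero (hb t) (hMY t).1, hzero (hb t) (hMY t).2⟩⟩

/-- Two closed curves that a Möbius transformation moves into the two coordinate circles
together cover the Hopf link. -/
lemma moeb_image_eq_stdHopfLink {x y : ℝ → Fin 4 → ℝ} {L₁ L₂ : ℝ}
    (hx : Continuous x) (hy : Continuous y)
    (hxS : ∀ s, x s ⬝ᵥ x s = 1) (hyS : ∀ t, y t ⬝ᵥ y t = 1) (hL₁ : 0 < L₁) (hL₂ : 0 < L₂)
    (hperx : ∀ s, x (s + L₁) = x s) (hpery : ∀ t, y (t + L₂) = y t)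
    (hxinj : Set.InjOn x (Set.Ico 0 L₁)) (hyinj : Set.InjOn y (Set.Ico 0 L₂))
    {M : Matrix (Fin 5) (Fin 5) ℝ}
    (hM : ∀ u v : Fin 5 → ℝ, MinkB (M.mulVec u) (M.mulVec v) = MinkB u v)
    (hpos : ∀ z : Fin 4 → ℝ, z ⬝ᵥ z = 1 → 0 < M.mulVec (lift z) 0)
    (hMx : ∀ s, Moeb M (x s) 2 = 0 ∧ Moeb M (x s) 3 = 0)
    (hMy : ∀ t, Moeb M (y t) 0 = 0 ∧ Moeb M (y t) 1 = 0) :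
    Moeb M '' (Set.range x ∪ Set.range y) = stdHopfLink := by
  have hxeq s : Moeb M (x s) = ![Moeb M (x s) 0, Moeb M (x s) 1, 0, 0] := by
    funext i; fin_cases i <;> simp [hMx]
  have hyeq t : Moeb M (y t) = ![0, 0, Moeb M (y t) 2, Moeb M (y t) 3] := by
    funext i; fin_cases i <;> simp [hMy]
  have hxsq s : Moeb M (x s) 0 ^ 2 + Moeb M (x s) 1 ^ 2 = 1 := by
    have := moeb_self_dotProduct hM hpos (hxS s)
    simp only [dotProduct, Fin.sum_univ_four, hMx] at this
    linarith
  have hysq t : Moeb M (y t) 2 ^ 2 + Moeb M (y t) 3 ^ 2 = 1 := by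
    have := moeb_self_dotProduct hM hpos (hyS t)
    simp only [dotProduct, Fin.sum_univ_four, hMy] at this
    linarith
  have hxc := continuous_moeb_comp hx fun s => hpos _ (hxS s)
  have hyc := continuous_moeb_comp hy fun t => hpos _ (hyS t)
  have hinj := moeb_injOn_sphere hM hpos
  have hxL : x L₁ = x 0 := by simpa using hperx 0
  have hyL : y L₂ = y 0 := by simpa using hpery 0
  rw [Set.image_union, ← Set.range_comp, ← Set.range_comp, stdHopfLink]
  congr 1
  · ext p
    constructor
    · rintro ⟨s, rfl⟩
      obtain ⟨θ, h0, h1⟩ := exists_cos_sin_of_sq_add_sq_eq_one (hxsq s)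
      exact ⟨θ, by rw [Function.comp_apply, hxeq, h0, h1]⟩
    · rintro ⟨θ, rfl⟩
      obtain ⟨s, h0, h1⟩ := exists_eq_cos_sin_of_periodic_injOn (p := fun s => Moeb M (x s) 0)
        (q := fun s => Moeb M (x s) 1) hL₁ ((continuous_apply _).comp hxc)
        ((continuous_apply _).comp hxc) hxsq (by simp only [hxL]) (by simp only [hxL])
        (fun s hs s' hs' h => hxinj hs hs' (hinj (hxS s) (hxS s') (by
          rw [hxeq s, hxeq s', (Prod.mk.inj h).1, (Prod.mk.inj h).2]))) θ
      exact ⟨s, by rw [Function.comp_apply, hxeq, h0, h1]⟩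
  · ext p
    constructor
    · rintro ⟨t, rfl⟩
      obtain ⟨θ, h0, h1⟩ := exists_cos_sin_of_sq_add_sq_eq_one (hysq t)
      exact ⟨θ, by rw [Function.comp_apply, hyeq, h0, h1]⟩
    · rintro ⟨θ, rfl⟩
      obtain ⟨t, h0, h1⟩ := exists_eq_cos_sin_of_periodic_injOn (p := fun t => Moeb M (y t) 2)
        (q := fun t => Moeb M (y t) 3) hL₂ ((continuous_apply _).comp hyc)
        ((continuous_apply _).comp hyc) hysq (by simp only [hyL]) (by simp only [hyL])
        (fun t ht t' ht' h => hyinj ht ht' (hinj (hyS t) (hyS t') (by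
          rw [hyeq t, hyeq t', (Prod.mk.inj h).1, (Prod.mk.inj h).2]))) θ
      exact ⟨t, by rw [Function.comp_apply, hyeq, h0, h1]⟩

/-- Two curves jointly covering the Hopf link lie in different components of it. -/
lemma dotProduct_eq_zero_of_union_eq_stdHopfLink {c d : ℝ → Fin 4 → ℝ} (hc : Continuous c)
    (hd : Continuous d) (h : Set.range c ∪ Set.range d = stdHopfLink) (s t : ℝ) :
    c s ⬝ᵥ d t = 0 := by
  have hcH s : c s ∈ stdHopfLink := h ▸ Or.inl ⟨s, rfl⟩
  have hdH t : d t ∈ stdHopfLink := h ▸ Or.inr ⟨t, rfl⟩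
  rcases mem_component_of_mem_stdHopfLink hc hcH with h1 | h1 <;>
    rcases mem_component_of_mem_stdHopfLink hd hdH with h2 | h2
  · have hp : ![0, 0, Real.cos 0, Real.sin 0] ∈ stdHopfLink := Or.inr ⟨0, rfl⟩
    rw [← h] at hp
    rcases hp with ⟨r, hr⟩ | ⟨r, hr⟩
    · have := (h1 r).1; rw [hr] at this; simp at this
    · have := (h2 r).1; rw [hr] at this; simp at this
  · simp [dotProduct, Fin.sum_univ_four, h1, h2]
  · simp [dotProduct, Fin.sum_univ_four, h1, h2]
  · have hp : ![Real.cos 0, Real.sin 0, 0, 0] ∈ stdHopfLink := Or.inl ⟨0, rfl⟩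
    rw [← h] at hp
    rcases hp with ⟨r, hr⟩ | ⟨r, hr⟩
    · have := (h1 r).1; rw [hr] at this; simp at this
    · have := (h2 r).1; rw [hr] at this; simp at this

/-- main theorem: the area of the product torus of a 2-component link
vanishes if and only if the link is the image of the standard Hopf link by a Möbius
transformation. -/
theorem area_zero_iff_moebius_image_of_hopf_link
    (x y : ℝ → (Fin 4 → ℝ)) (L₁ L₂ : ℝ)
    (hx : ContDiff ℝ 1 x) (hy : ContDiff ℝ 1 y)
    (hxS : ∀ s, x s ⬝ᵥ x s = 1) (hyS : ∀ t, y t ⬝ᵥ y t = 1)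
    (hL₁ : 0 < L₁) (hL₂ : 0 < L₂)
    (hperx : ∀ s, x (s + L₁) = x s) (hpery : ∀ t, y (t + L₂) = y t)
    (hxinj : Set.InjOn x (Set.Ico 0 L₁)) (hyinj : Set.InjOn y (Set.Ico 0 L₂))
    (hx' : ∀ s, deriv x s ≠ 0) (hy' : ∀ t, deriv y t ≠ 0)
    (hdisj : ∀ s t, x s ≠ y t) :
    (∫ s in (0:ℝ)..L₁, ∫ t in (0:ℝ)..L₂,
      |((deriv x s ⬝ᵥ deriv y t) * (x s ⬝ᵥ y t - 1)
        - (deriv x s ⬝ᵥ y t) * (x s ⬝ᵥ deriv y t)) / (x s ⬝ᵥ y t - 1) ^ 2|) = 0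
    ↔
    ∃ M : Matrix (Fin 5) (Fin 5) ℝ,
      (∀ u v : Fin 5 → ℝ, MinkB (M.mulVec u) (M.mulVec v) = MinkB u v) ∧
      (∀ z : Fin 4 → ℝ, z ⬝ᵥ z = 1 → 0 < M.mulVec (lift z) 0) ∧
      Moeb M '' (Set.range x ∪ Set.range y) = stdHopfLink := by
  have hneg (s t) := dotProduct_sub_one_neg (hxS s) (hyS t) (hdisj s t)
  have hxd : Differentiable ℝ x := hx.differentiable one_ne_zero
  have hyd : Differentiable ℝ y := hy.differentiable one_ne_zero
  have hiff := areaDensity_eq_zero_iff hxd hyd fun s t => (hneg s t).ne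
  constructor
  · intro h
    have hA := eq_zero_of_integral_integral_eq_zero hL₁ hL₂ (by
        have hx'c := hx.continuous_deriv_one
        have hy'c := hy.continuous_deriv_one
        have hxc := hx.continuous
        have hyc := hy.continuous
        refine Continuous.abs (Continuous.div ?_ ?_ fun r => pow_ne_zero 2 (hneg r.1 r.2).ne) <;>
          simp only [dotProduct] <;> fun_prop)
      (fun s t => abs_nonneg _)
      (fun s => by simp only [hperx, deriv_periodic hperx s])
      (fun s t => by simp only [hpery, deriv_periodic hpery t]) h
    have hA' := hiff.1 fun s t => by
      have := abs_eq_zero.1 (hA s t)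
      exact (div_eq_zero_iff.1 this).resolve_right (pow_ne_zero 2 (hneg s t).ne)
    obtain ⟨M, hM, hpos, hMx, hMy⟩ :=
      exists_lorentz_of_product hxS hyS hL₁ hL₂ hxinj hyinj hdisj hA'
    exact ⟨M, hM, hpos, moeb_image_eq_stdHopfLink hx.continuous hy.continuous hxS hyS hL₁ hL₂
      hperx hpery hxinj hyinj hM hpos hMx hMy⟩
  · rintro ⟨M, hM, hpos, himg⟩
    have hdot := dotProduct_eq_zero_of_union_eq_stdHopfLink
      (continuous_moeb_comp hx.continuous fun s => hpos _ (hxS s))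
      (continuous_moeb_comp hy.continuous fun t => hpos _ (hyS t))
      (by rw [← himg, Set.image_union, ← Set.range_comp, ← Set.range_comp]; rfl)
    have hF (s t) : x s ⬝ᵥ y t - 1 =
        M.mulVec (lift (x s)) 0 * M.mulVec (lift (y t)) 0 * (0 - 1) := by
      rw [dotProduct_sub_one_eq_moeb hM (hpos _ (hxS s)).ne' (hpos _ (hyS t)).ne', hdot]
    have hA := hiff.2 fun s s' t t' => by simp only [hF]; ring
    simp [hA]
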